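/- arXiv:2005.05873 — 3 statements merged into one kernel-verified Lean document; each statement's English description precedes it below -/
import Mathlib

section
/- Let N ≥ 1 and K ≥ 1 be integers and let Δ_1, …, Δ_K be natural numbers, not all zero, with the convention Δ_j = 0 for j ≤ 0. Then Σ_{i=1}^{K} Σ_{k=1}^{Δ_i} ( k + Σ_{j=1}^{N-1} Δ_{i-j} ) ≤ 2N · Σ_{i=1}^{K} Σ_{k=1}^{Δ_i} (1 + k). -/
theorem two_mul_sum_Icc_one_id (n : ℕ) : 2 * ∑ k ∈ Finset.Icc 1 n, k = n ^ 2 + n := by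
  induction n with
  | zero => simp
  | succ n ih =>
    rw [Finset.sum_Icc_succ_top (by omega), mul_add, ih]
    ring

/-- Shifting a sequence that vanishes at nonpositive indices to the right does not increase
its partial sums. -/
theorem sum_Icc_one_sub_le {f : ℤ → ℕ} (hf : ∀ i ≤ 0, f i = 0) (n : ℤ) {j : ℤ} (hj : 0 ≤ j) :
    ∑ i ∈ Finset.Icc 1 n, f (i - j) ≤ ∑ i ∈ Finset.Icc 1 n, f i := by
  rw [← Finset.sum_image (f := f) (g := fun i : ℤ => i - j)
    (fun a _ b _ h => sub_left_injective h)]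
  refine Finset.sum_le_sum_of_ne_zero fun x hx hfx => ?_
  obtain ⟨i, hi, rfl⟩ := Finset.mem_image.mp hx
  have hpos : 0 < i - j := not_le.mp fun h => hfx (hf _ h)
  rw [Finset.mem_Icc] at hi ⊢
  omega

/-- The lag-`j` autocorrelation of a sequence is at most its energy. -/
theorem two_mul_sum_mul_sub_le {f : ℤ → ℕ} (hf : ∀ i ≤ 0, f i = 0) (n : ℤ) {j : ℤ}
    (hj : 0 ≤ j) :
    2 * ∑ i ∈ Finset.Icc 1 n, f i * f (i - j) ≤ 2 * ∑ i ∈ Finset.Icc 1 n, f i ^ 2 := by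
  have hshift := sum_Icc_one_sub_le (f := fun i => f i ^ 2) (fun i hi => by simp [hf i hi]) n hj
  calc 2 * ∑ i ∈ Finset.Icc 1 n, f i * f (i - j)
      ≤ ∑ i ∈ Finset.Icc 1 n, (f i ^ 2 + f (i - j) ^ 2) := by
        rw [Finset.mul_sum]
        refine Finset.sum_le_sum fun i _ => ?_
        rw [← mul_assoc]
        exact two_mul_le_add_sq _ _
    _ ≤ 2 * ∑ i ∈ Finset.Icc 1 n, f i ^ 2 := by
        rw [Finset.sum_add_distrib]
        linarith

/-- Abstracted numerical content of Theorem 1 (`η^CMA ≤ 2N`):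
`∑_{i=1}^K ∑_{k=1}^{Δ_i} (k + ∑_{j=1}^{N-1} Δ_{i-j})
  ≤ 2N ∑_{i=1}^K ∑_{k=1}^{Δ_i} (1 + k)`. -/
theorem stmt1 (N K : ℕ) (hN : 1 ≤ N) (hK : 1 ≤ K) (Δ : ℤ → ℕ)
    (hnontriv : ∃ i ∈ Finset.Icc (1 : ℤ) K, Δ i ≠ 0)
    (hzero : ∀ j : ℤ, j ≤ 0 → Δ j = 0) :
    ∑ i ∈ Finset.Icc (1 : ℤ) K, ∑ k ∈ Finset.Icc 1 (Δ i),
        (k + ∑ j ∈ Finset.Icc (1 : ℤ) ((N : ℤ) - 1), Δ (i - j))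
    ≤ 2 * N * ∑ i ∈ Finset.Icc (1 : ℤ) K, ∑ k ∈ Finset.Icc 1 (Δ i), (1 + k) := by
  obtain ⟨M, rfl⟩ : ∃ M, N = M + 1 := ⟨N - 1, by omega⟩
  have hcross : ∑ i ∈ Finset.Icc (1 : ℤ) K,
      Δ i * ∑ j ∈ Finset.Icc (1 : ℤ) (((M + 1 : ℕ) : ℤ) - 1), Δ (i - j)
      ≤ M * ∑ i ∈ Finset.Icc (1 : ℤ) K, Δ i ^ 2 := by
    simp_rw [Finset.mul_sum (Finset.Icc (1 : ℤ) (((M + 1 : ℕ) : ℤ) - 1))]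
    rw [Finset.sum_comm]
    refine (Finset.sum_le_card_nsmul _ _ (∑ i ∈ Finset.Icc (1 : ℤ) K, Δ i ^ 2)
      fun j hj => ?_).trans_eq (by simp)
    have hj0 : 0 ≤ j := zero_le_one.trans (Finset.mem_Icc.mp hj).1
    exact Nat.le_of_mul_le_mul_left (two_mul_sum_mul_sub_le hzero K hj0) two_pos
  have hgauss : 2 * ∑ i ∈ Finset.Icc (1 : ℤ) K, ∑ k ∈ Finset.Icc 1 (Δ i), k
      = ∑ i ∈ Finset.Icc (1 : ℤ) K, Δ i ^ 2 + ∑ i ∈ Finset.Icc (1 : ℤ) K, Δ i := by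
    simp_rw [Finset.mul_sum (Finset.Icc (1 : ℤ) K), two_mul_sum_Icc_one_id,
      Finset.sum_add_distrib]
  have hle : ∑ i ∈ Finset.Icc (1 : ℤ) K, ∑ k ∈ Finset.Icc 1 (Δ i), k
      ≤ ∑ i ∈ Finset.Icc (1 : ℤ) K, ∑ k ∈ Finset.Icc 1 (Δ i), (1 + k) :=
    Finset.sum_le_sum fun i _ => Finset.sum_le_sum fun k _ => Nat.le_add_left k 1
  refine le_trans ?_ (Nat.mul_le_mul_left _ hle)
  simp only [Finset.sum_add_distrib, Finset.sum_const, Nat.card_Icc, smul_eq_mul,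
    add_tsub_cancel_right]
  rw [mul_comm 2 (M + 1), mul_assoc, hgauss]
  generalize ∑ i ∈ Finset.Icc (1 : ℤ) K, ∑ k ∈ Finset.Icc 1 (Δ i), k = S at hgauss ⊢
  generalize ∑ i ∈ Finset.Icc (1 : ℤ) K, Δ i ^ 2 = Q at hcross hgauss ⊢
  generalize ∑ i ∈ Finset.Icc (1 : ℤ) K, Δ i = D at hgauss ⊢
  nlinarith [Nat.zero_le (M * D)]
end

section
/- Let 0 < α < 1. Then for every real x with 0 < x < 1, (1 - (1-x)e^{αx})/x ≥ (1-α)/(1-αx) ≥ 1 - α. -/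
/-- For `0 < α < 1` and `0 < x < 1`,
`(1 - (1-x) e^{αx})/x ≥ (1-α)/(1-αx) ≥ 1 - α`. -/
theorem stmt6 (α : ℝ) (hα0 : 0 < α) (hα1 : α < 1) (x : ℝ)
    (hx0 : 0 < x) (hx1 : x < 1) :
    (1 - α) / (1 - α * x) ≤ (1 - (1 - x) * Real.exp (α * x)) / x ∧
      1 - α ≤ (1 - α) / (1 - α * x) := by
  have hαx0 : 0 < α * x := mul_pos hα0 hx0
  have hαx1 : α * x < 1 := by nlinarith
  have hden : 0 < 1 - α * x := sub_pos.mpr hαx1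
  constructor
  · have hexp : Real.exp (α * x) ≤ 1 / (1 - α * x) :=
      Real.exp_bound_div_one_sub_of_interval hαx0.le hαx1
    have hmul : (1 - x) * Real.exp (α * x) ≤ (1 - x) * (1 / (1 - α * x)) :=
      mul_le_mul_of_nonneg_left hexp (sub_nonneg.mpr hx1.le)
    have heq : (1 - α) / (1 - α * x) * x = 1 - (1 - x) * (1 / (1 - α * x)) := by
      field_simp [hden.ne']
      ring
    rw [le_div_iff₀ hx0, heq]
    linarith
  · rw [le_div_iff₀ hden]
    nlinarith [mul_pos (sub_pos.mpr hα1) hαx0]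
end

section
/- Let 0 < α < 1. Then the infimum over x ∈ (0,1) of the function x ↦ (1 - (1-x)e^{αx})/x equals 1 - α; that is, (1 - (1-x)e^{αx})/x ≥ 1 - α for all 0 < x < 1, and the function tends to 1 - α as x → 0⁺, so the infimum is not attained but equals 1-α. -/
theorem one_sub_le_one_sub_one_sub_mul_exp_div {α x : ℝ} (hα0 : 0 < α) (hα1 : α < 1)
    (hx0 : 0 < x) (hx1 : x < 1) :
    1 - α ≤ (1 - (1 - x) * Real.exp (α * x)) / x := by
  have hpos : 0 < 1 - α * x := by nlinarith
  have hexp : Real.exp (α * x) ≤ (1 - α * x)⁻¹ := by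
    rw [← neg_neg (α * x), Real.exp_neg, neg_neg]
    exact inv_anti₀ hpos (Real.one_sub_le_exp_neg _)
  have hmul : (1 - x) * (1 - α * x)⁻¹ ≤ 1 - (1 - α) * x := by
    rw [← div_eq_mul_inv, div_le_iff₀ hpos]
    nlinarith [mul_nonneg (mul_nonneg hα0.le (sub_nonneg.2 hα1.le)) (sq_nonneg x)]
  rw [le_div_iff₀ hx0]
  linarith [mul_le_mul_of_nonneg_left hexp (sub_nonneg.2 hx1.le)]

theorem tendsto_one_sub_one_sub_mul_exp_div (α : ℝ) :
    Filter.Tendsto (fun x : ℝ => (1 - (1 - x) * Real.exp (α * x)) / x)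
      (nhdsWithin 0 (Set.Ioi 0)) (nhds (1 - α)) := by
  have hderiv : HasDerivAt (fun x : ℝ => 1 - (1 - x) * Real.exp (α * x)) (1 - α) 0 := by
    have h := (((hasDerivAt_id (0 : ℝ)).const_sub 1).mul
      ((hasDerivAt_id (0 : ℝ)).const_mul α).exp).const_sub 1
    exact h.congr_deriv (by simp; ring)
  simpa [div_eq_inv_mul] using hderiv.tendsto_slope_zero_right

/-- Equation (analysis1): for fixed `0 < α < 1`, the infimum over `x ∈ (0,1)` of
`(1 - (1-x)e^{αx})/x` equals `1 - α`: the function is bounded below by `1 - α`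
on `(0,1)`, tends to `1 - α` as `x → 0⁺`, and `1 - α` is its greatest lower
bound on `(0,1)`. -/
theorem stmt7 (α : ℝ) (hα0 : 0 < α) (hα1 : α < 1) :
    (∀ x : ℝ, 0 < x → x < 1 →
        1 - α ≤ (1 - (1 - x) * Real.exp (α * x)) / x) ∧
      Filter.Tendsto (fun x : ℝ => (1 - (1 - x) * Real.exp (α * x)) / x)
        (nhdsWithin 0 (Set.Ioi 0)) (nhds (1 - α)) ∧
      IsGLB ((fun x : ℝ => (1 - (1 - x) * Real.exp (α * x)) / x) '' Set.Ioo 0 1)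
        (1 - α) := by
  have hle := fun x => one_sub_le_one_sub_one_sub_mul_exp_div (x := x) hα0 hα1
  have hlim := tendsto_one_sub_one_sub_mul_exp_div α
  refine ⟨hle, hlim, ?_, fun b hb => ?_⟩
  · rintro _ ⟨x, hx, rfl⟩
    exact hle x hx.1 hx.2
  · refine ge_of_tendsto hlim ?_
    filter_upwards [Ioo_mem_nhdsGT (zero_lt_one' ℝ)] with x hx
    exact hb ⟨x, hx, rfl⟩
end
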